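/- Every even binary word in which every 1-run has length exactly one and every 0-run has length at most two is a shuffle square, except for the word 1001. -/

import Mathlib

/-- `Interleave x y z` means that `z` is an interleaving (shuffle) of the words
`x` and `y`. -/
inductive Interleave {α : Type*} : List α → List α → List α → Prop
  | nil : Interleave [] [] []
  | cons_left (a : α) {xs ys zs : List α} :
      Interleave xs ys zs → Interleave (a :: xs) ys (a :: zs)
  | cons_right (a : α) {xs ys zs : List α} :
      Interleave xs ys zs → Interleave xs (a :: ys) (a :: zs)

/-- A word is a shuffle square if it is an interleaving of two copies of the same word. -/
def IsShuffleSquare {α : Type*} (w : List α) : Prop :=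
  ∃ x : List α, Interleave x x w

/-- `RunDecomp w rs` says that `rs` is the run decomposition of `w`: the word `w` is the
concatenation of blocks `p.1 ^ p.2` for `p ∈ rs`, all blocks are nonempty, and the letters
of consecutive blocks differ (so the blocks are exactly the maximal runs of `w`). -/
def RunDecomp {α : Type*} (w : List α) (rs : List (α × ℕ)) : Prop :=
  w = (rs.map fun p => List.replicate p.2 p.1).flatten ∧
  (∀ p ∈ rs, 0 < p.2) ∧
  List.Chain' (fun p q => p.1 ≠ q.1) rs

/-- `Completes u w`: the word `w` completes a pair of copies one of which is ahead of the other
by the pending word `u`. -/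
def Completes {α : Type*} (u w : List α) : Prop :=
  ∃ x, Interleave x (u ++ x) w

namespace Completes

variable {α : Type*} {a : α} {u w : List α}

theorem nil : Completes ([] : List α) [] :=
  ⟨[], .nil⟩

/-- The copy that is ahead takes the next letter. -/
theorem push (h : Completes (u ++ [a]) w) : Completes u (a :: w) := by
  obtain ⟨x, hx⟩ := h
  exact ⟨a :: x, .cons_left a (by simpa using hx)⟩

/-- The copy that is behind takes the next letter. -/
theorem pop (h : Completes u w) : Completes (a :: u) (a :: w) := by
  obtain ⟨x, hx⟩ := h
  exact ⟨x, .cons_right a hx⟩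

theorem isShuffleSquare (h : Completes [] w) : IsShuffleSquare w :=
  h

end Completes

/-- All pending words of length at most three reachable from a member of `S` by reading `a`. -/
def stepQueues (S : List (List Bool)) (a : Bool) : List (List Bool) :=
  (S.flatMap fun u =>
    (if u.length < 3 then [u ++ [a]] else []) ++
      (if u.head? = some a then [u.tail] else [])).dedup

theorem exists_completes_cons {S : List (List Bool)} {a : Bool} {w : List Bool}
    (h : ∃ u ∈ stepQueues S a, Completes u w) : ∃ u ∈ S, Completes u (a :: w) := by
  obtain ⟨v, hv, hw⟩ := h
  simp only [stepQueues, List.mem_dedup, List.mem_flatMap, List.mem_append,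
    List.mem_ite_nil_right, List.mem_singleton] at hv
  obtain ⟨u, hu, ⟨-, rfl⟩ | ⟨ha, rfl⟩⟩ := hv
  · exact ⟨u, hu, hw.push⟩
  · obtain ⟨u', rfl⟩ := List.head?_eq_some_iff.mp ha
    exact ⟨_, hu, hw.pop⟩

/-- `RunBounded m n w`: the word `w` starts with at most `m` ones or at most `n` zeros, and all
later runs of ones and of zeros have length at most one and two, respectively. -/
def RunBounded : ℕ → ℕ → List Bool → Prop
  | _, _, [] => True
  | m, _, true :: w => 0 < m ∧ RunBounded 0 2 w
  | _, n, false :: w => 0 < n ∧ RunBounded 1 (n - 1) w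

theorem RunDecomp.runBounded {w : List Bool} {rs : List (Bool × ℕ)} (h : RunDecomp w rs)
    (hruns : ∀ p ∈ rs, (p.1 = true → p.2 = 1) ∧ (p.1 = false → p.2 ≤ 2)) {m n : ℕ}
    (hm : ∀ p ∈ rs.head?, p.1 = true → 0 < m)
    (hn : ∀ p ∈ rs.head?, p.1 = false → n = 2) :
    RunBounded m n w := by
  obtain ⟨rfl, hpos, hchain⟩ := h
  induction rs generalizing m n with
  | nil => trivial
  | cons p rs ih =>
    obtain ⟨hne, hchain⟩ := List.isChain_cons.mp hchain
    have ih {m n : ℕ} := ih (m := m) (n := n) (fun q hq => hruns q (by simp [hq]))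
    have hp := hruns p (by simp)
    have hp0 := hpos p (by simp)
    replace ih {m n : ℕ} := fun h₁ h₂ => ih (m := m) (n := n) h₁ h₂
      (fun q hq => hpos q (by simp [hq])) hchain
    obtain ⟨b, k⟩ := p
    cases b with
    | true =>
      obtain rfl : k = 1 := hp.1 rfl
      refine ⟨hm _ rfl rfl, ih (fun q hq hq' => absurd hq'.symm (hne q hq)) fun _ _ _ => rfl⟩
    | false =>
      obtain rfl : n = 2 := hn _ rfl rfl
      have hk : k ≤ 2 := hp.2 rfl
      have key (n : ℕ) := ih (m := 1) (n := n) (fun _ _ _ => one_pos)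
        (fun q hq hq' => absurd hq'.symm (hne q hq))
      obtain rfl | rfl : k = 1 ∨ k = 2 := by simp only at hp0; omega
      · exact ⟨two_pos, key 1⟩
      · exact ⟨two_pos, one_pos, key 0⟩

/-- What is known about the unread part of a word: bounds on its initial runs, the parities of
the numbers of ones and zeros, a word it must differ from, and the possible pending words. -/
structure ReadState where
  /-- The bound on an initial run of ones. -/
  ones : ℕ
  /-- The bound on an initial run of zeros. -/
  zeros : ℕ
  /-- Whether the number of ones is odd. -/
  oddOnes : Bool
  /-- Whether the number of zeros is odd. -/
  oddZeros : Bool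
  /-- The excluded word, if any. -/
  excluded : Option (List Bool)
  /-- The possible pending words. -/
  queues : List (List Bool)
deriving DecidableEq

namespace ReadState

/-- The word `w` satisfies the constraints recorded in `s`. -/
def Admits (s : ReadState) (w : List Bool) : Prop :=
  RunBounded s.ones s.zeros w ∧ (w.count true).bodd = s.oddOnes ∧
    (w.count false).bodd = s.oddZeros ∧ s.excluded ≠ some w

/-- The state after reading a one. -/
def readOne (s : ReadState) : ReadState where
  ones := 0
  zeros := 2
  oddOnes := !s.oddOnes
  oddZeros := s.oddZeros
  excluded := (s.excluded.filter (·.head? = some true)).map List.tail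
  queues := stepQueues s.queues true

/-- The state after reading a zero. -/
def readZero (s : ReadState) : ReadState where
  ones := 1
  zeros := s.zeros - 1
  oddOnes := s.oddOnes
  oddZeros := !s.oddZeros
  excluded := (s.excluded.filter (·.head? = some false)).map List.tail
  queues := stepQueues s.queues false

/-- The states that can follow `s`. -/
def next (s : ReadState) : List ReadState :=
  (if 0 < s.ones then [s.readOne] else []) ++ if 0 < s.zeros then [s.readZero] else []

/-- The state before reading an even word other than `1001`. -/
def start : ReadState :=
  ⟨1, 2, false, false, some [true, false, false, true], [[]]⟩

/-- All states reachable from `start`. -/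
def reachable : List ReadState :=
  (fun l => l.flatMap next ∪ l)^[9] [start]

theorem next_mem_reachable : ∀ s ∈ reachable, ∀ t ∈ s.next, t ∈ reachable := by
  decide +kernel

theorem nil_mem_queues : ∀ s ∈ reachable,
    s.oddOnes = false → s.oddZeros = false → s.excluded ≠ some [] → [] ∈ s.queues := by
  decide +kernel

theorem start_mem_reachable : start ∈ reachable := by
  decide +kernel

theorem Admits.readOne {s : ReadState} {w : List Bool} (h : s.Admits (true :: w)) :
    s.readOne ∈ s.next ∧ s.readOne.Admits w := by
  obtain ⟨⟨hm, hw⟩, h₁, h₀, he⟩ := h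
  refine ⟨by simp [next, hm], hw, ?_, by simpa [ReadState.readOne] using h₀, ?_⟩
  · simp [ReadState.readOne, ← h₁]
  · contrapose! he
    obtain ⟨e, ⟨hs, hhead⟩, rfl⟩ :
        ∃ e, (s.excluded = some e ∧ e.head? = some true) ∧ e.tail = w := by
      simpa [ReadState.readOne, Option.filter_eq_some_iff] using he
    obtain ⟨v, rfl⟩ := List.head?_eq_some_iff.mp hhead
    exact hs

theorem Admits.readZero {s : ReadState} {w : List Bool} (h : s.Admits (false :: w)) :
    s.readZero ∈ s.next ∧ s.readZero.Admits w := by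
  obtain ⟨⟨hn, hw⟩, h₁, h₀, he⟩ := h
  refine ⟨by simp [next, hn], hw, by simpa [ReadState.readZero] using h₁, ?_, ?_⟩
  · simp [ReadState.readZero, ← h₀]
  · contrapose! he
    obtain ⟨e, ⟨hs, hhead⟩, rfl⟩ :
        ∃ e, (s.excluded = some e ∧ e.head? = some false) ∧ e.tail = w := by
      simpa [ReadState.readZero, Option.filter_eq_some_iff] using he
    obtain ⟨v, rfl⟩ := List.head?_eq_some_iff.mp hhead
    exact hs

theorem Admits.exists_completes {w : List Bool} {s : ReadState} (hs : s ∈ reachable)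
    (h : s.Admits w) : ∃ u ∈ s.queues, Completes u w := by
  induction w generalizing s with
  | nil =>
    obtain ⟨-, h₁, h₀, he⟩ := h
    exact ⟨[], nil_mem_queues s hs h₁.symm h₀.symm he, .nil⟩
  | cons a w ih =>
    cases a with
    | true => exact exists_completes_cons (ih (next_mem_reachable s hs _ h.readOne.1) h.readOne.2)
    | false =>
      exact exists_completes_cons (ih (next_mem_reachable s hs _ h.readZero.1) h.readZero.2)

end ReadState

theorem Nat.bodd_eq_false_of_even {n : ℕ} (h : Even n) : n.bodd = false := by
  obtain ⟨k, rfl⟩ := h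
  simp

/-- Every even binary word whose `1`-runs all have length exactly one and whose `0`-runs
all have length at most two is a shuffle square, except for the word `1001`. -/
theorem statement6 (w : List Bool) (rs : List (Bool × ℕ)) (hrd : RunDecomp w rs)
    (heven1 : Even (w.count true)) (heven0 : Even (w.count false))
    (hruns : ∀ p ∈ rs, (p.1 = true → p.2 = 1) ∧ (p.1 = false → p.2 ≤ 2))
    (hnot : w ≠ [true, false, false, true]) :
    IsShuffleSquare w := by
  have h : ReadState.start.Admits w :=
    ⟨hrd.runBounded hruns (fun _ _ _ => one_pos) fun _ _ _ => rfl,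
      Nat.bodd_eq_false_of_even heven1, Nat.bodd_eq_false_of_even heven0,
      fun he => hnot (Option.some.inj he).symm⟩
  obtain ⟨u, hu, hw⟩ := h.exists_completes ReadState.start_mem_reachable
  obtain rfl := List.mem_singleton.mp hu
  exact hw.isShuffleSquare
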